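/- arXiv:2307.07689 — 2 statements merged into one kernel-verified Lean document; each statement's English description precedes it below -/
import Mathlib

section
/- Let T > 0 and let G, Ĝ ∈ ℝ^{m×k} with GᵀG = T·I_k. Let β ∈ ℝ^k, ε ∈ ℝ^m, y = Gβ + ε, and define the forecast ŷ = (1/T)ĜĜᵀy. Let H ∈ ℝ^{k×k} be arbitrary and set E = Ĝ − GHᵀ. Then (i) y − ŷ = (I_m − (1/T)GGᵀ)ε + (1/T)(GGᵀ − ĜĜᵀ)y; (ii) GGᵀ − ĜĜᵀ = G(I_k − HᵀH)Gᵀ − GHᵀEᵀ − EHGᵀ − EEᵀ; and (iii) ‖y − ŷ − (I_m − (1/T)GGᵀ)ε‖ ≤ ( ‖I_k − HᵀH‖₂ + (2/√T)·‖H‖₂·‖E‖₂ + (1/T)·‖E‖₂² ) · ‖y‖. -/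
open Matrix

/-- The Euclidean norm of a vector in `ℝ^n`. -/
noncomputable def vnorm {n : ℕ} (v : Fin n → ℝ) : ℝ :=
  Real.sqrt (∑ i, (v i) ^ 2)

/-- The operator (spectral) norm of a real matrix, i.e. the norm of the induced
continuous linear map between Euclidean spaces. -/
noncomputable def opNorm {m k : ℕ} (A : Matrix (Fin m) (Fin k) ℝ) : ℝ :=
  ‖LinearMap.toContinuousLinearMap (Matrix.toEuclideanLin A)‖

section

open scoped Matrix.Norms.L2Operator

theorem vnorm_eq_norm_toLp {n : ℕ} (v : Fin n → ℝ) : vnorm v = ‖WithLp.toLp 2 v‖ := by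
  simp [vnorm, EuclideanSpace.norm_eq]

theorem opNorm_eq_norm {m k : ℕ} (A : Matrix (Fin m) (Fin k) ℝ) : opNorm A = ‖A‖ := by
  rw [Matrix.l2_opNorm_def]
  rfl

theorem opNorm_nonneg {m k : ℕ} (A : Matrix (Fin m) (Fin k) ℝ) : 0 ≤ opNorm A :=
  norm_nonneg _

theorem vnorm_mulVec_le {m k : ℕ} (A : Matrix (Fin m) (Fin k) ℝ) (v : Fin k → ℝ) :
    vnorm (A.mulVec v) ≤ opNorm A * vnorm v := by
  rw [vnorm_eq_norm_toLp, vnorm_eq_norm_toLp, opNorm_eq_norm]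
  exact Matrix.l2_opNorm_mulVec A (WithLp.toLp 2 v)

theorem vnorm_smul {n : ℕ} (c : ℝ) (v : Fin n → ℝ) : vnorm (c • v) = |c| * vnorm v := by
  rw [vnorm_eq_norm_toLp, vnorm_eq_norm_toLp, WithLp.toLp_smul, norm_smul, Real.norm_eq_abs]

theorem opNorm_transpose {m k : ℕ} (A : Matrix (Fin m) (Fin k) ℝ) : opNorm Aᵀ = opNorm A := by
  rw [opNorm_eq_norm, opNorm_eq_norm, ← Matrix.conjTranspose_eq_transpose_of_trivial,
    Matrix.l2_opNorm_conjTranspose]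

theorem opNorm_mul_le {m k l : ℕ} (A : Matrix (Fin m) (Fin k) ℝ)
    (B : Matrix (Fin k) (Fin l) ℝ) : opNorm (A * B) ≤ opNorm A * opNorm B := by
  simp only [opNorm_eq_norm]
  exact Matrix.l2_opNorm_mul A B

theorem opNorm_sub_le {m k : ℕ} (A B : Matrix (Fin m) (Fin k) ℝ) :
    opNorm (A - B) ≤ opNorm A + opNorm B := by
  simp only [opNorm_eq_norm]
  exact norm_sub_le A B

theorem opNorm_one_le (k : ℕ) : opNorm (1 : Matrix (Fin k) (Fin k) ℝ) ≤ 1 := by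
  refine ContinuousLinearMap.opNorm_le_bound _ zero_le_one fun x => ?_
  simp [Matrix.toLpLin_one]

theorem opNorm_le_sqrt_of_transpose_mul_self {m k : ℕ} {T : ℝ} (hT : 0 ≤ T)
    {G : Matrix (Fin m) (Fin k) ℝ} (hG : Gᵀ * G = T • (1 : Matrix (Fin k) (Fin k) ℝ)) :
    opNorm G ≤ √T := by
  refine Real.le_sqrt_of_sq_le ?_
  have h := Matrix.l2_opNorm_conjTranspose_mul_self G
  rw [Matrix.conjTranspose_eq_transpose_of_trivial, hG, norm_smul, Real.norm_of_nonneg hT,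
    ← opNorm_eq_norm, ← opNorm_eq_norm] at h
  rw [sq, ← h]
  exact mul_le_of_le_one_right hT (opNorm_one_le k)

end

theorem opNorm_factor_expansion_le {m k : ℕ} {g : ℝ} {G : Matrix (Fin m) (Fin k) ℝ}
    (hG : opNorm G ≤ g) (E : Matrix (Fin m) (Fin k) ℝ) (D H : Matrix (Fin k) (Fin k) ℝ) :
    opNorm (G * D * Gᵀ - G * Hᵀ * Eᵀ - E * H * Gᵀ - E * Eᵀ)
      ≤ g ^ 2 * opNorm D + 2 * g * opNorm H * opNorm E + opNorm E ^ 2 := by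
  have hg : 0 ≤ g := (opNorm_nonneg G).trans hG
  have nE := opNorm_nonneg E
  have nH := opNorm_nonneg H
  have nD := opNorm_nonneg D
  have triple {B C : Matrix (Fin m) (Fin k) ℝ} (A : Matrix (Fin k) (Fin k) ℝ) :
      opNorm (B * A * Cᵀ) ≤ opNorm B * opNorm A * opNorm C := by
    refine (opNorm_mul_le _ _).trans ?_
    rw [opNorm_transpose]
    exact mul_le_mul_of_nonneg_right (opNorm_mul_le _ _) (opNorm_nonneg C)
  have h₁ : opNorm (G * D * Gᵀ) ≤ g * opNorm D * g :=
    (triple D).trans (by have := opNorm_nonneg G; gcongr)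
  have h₂ : opNorm (G * Hᵀ * Eᵀ) ≤ g * opNorm H * opNorm E := by
    refine (triple Hᵀ).trans ?_
    rw [opNorm_transpose]
    gcongr
  have h₃ : opNorm (E * H * Gᵀ) ≤ opNorm E * opNorm H * g :=
    (triple H).trans (by gcongr)
  have h₄ : opNorm (E * Eᵀ) ≤ opNorm E * opNorm E := by
    simpa only [opNorm_transpose] using opNorm_mul_le E Eᵀ
  have t₁ := opNorm_sub_le (G * D * Gᵀ - G * Hᵀ * Eᵀ - E * H * Gᵀ) (E * Eᵀ)
  have t₂ := opNorm_sub_le (G * D * Gᵀ - G * Hᵀ * Eᵀ) (E * H * Gᵀ)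
  have t₃ := opNorm_sub_le (G * D * Gᵀ) (G * Hᵀ * Eᵀ)
  linarith

/-- Deterministic decomposition of the forecast error of the
least-squares forecast `ŷ = (1/T)ĜĜᵀy` built from estimated factors `Ĝ`, where
`y = Gβ + ε`, `GᵀG = T·I` and `E = Ĝ − GHᵀ`:
(i) `y − ŷ = (I − (1/T)GGᵀ)ε + (1/T)(GGᵀ − ĜĜᵀ)y`;
(ii) `GGᵀ − ĜĜᵀ = G(I − HᵀH)Gᵀ − GHᵀEᵀ − EHGᵀ − EEᵀ`;
(iii) `‖y − ŷ − (I − (1/T)GGᵀ)ε‖ ≤ (‖I − HᵀH‖₂ + (2/√T)‖H‖₂‖E‖₂ + (1/T)‖E‖₂²)‖y‖`. -/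
theorem forecast_error_decomposition_estimated_factors
    (m k : ℕ) (T : ℝ) (hT : 0 < T)
    (G Gh : Matrix (Fin m) (Fin k) ℝ)
    (hG : Gᵀ * G = T • (1 : Matrix (Fin k) (Fin k) ℝ))
    (β : Fin k → ℝ) (ε : Fin m → ℝ) (y : Fin m → ℝ)
    (hy : y = G.mulVec β + ε)
    (yh : Fin m → ℝ) (hyh : yh = T⁻¹ • (Gh * Ghᵀ).mulVec y)
    (H : Matrix (Fin k) (Fin k) ℝ)
    (E : Matrix (Fin m) (Fin k) ℝ) (hE : E = Gh - G * Hᵀ) :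
    y - yh = ((1 : Matrix (Fin m) (Fin m) ℝ) - T⁻¹ • (G * Gᵀ)).mulVec ε
        + T⁻¹ • (G * Gᵀ - Gh * Ghᵀ).mulVec y
    ∧ G * Gᵀ - Gh * Ghᵀ
        = G * ((1 : Matrix (Fin k) (Fin k) ℝ) - Hᵀ * H) * Gᵀ
          - G * Hᵀ * Eᵀ - E * H * Gᵀ - E * Eᵀ
    ∧ vnorm (y - yh - ((1 : Matrix (Fin m) (Fin m) ℝ) - T⁻¹ • (G * Gᵀ)).mulVec ε)
        ≤ (opNorm ((1 : Matrix (Fin k) (Fin k) ℝ) - Hᵀ * H)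
            + (2 / Real.sqrt T) * opNorm H * opNorm E
            + T⁻¹ * opNorm E ^ 2) * vnorm y := by
  have h₁ : y - yh = ((1 : Matrix (Fin m) (Fin m) ℝ) - T⁻¹ • (G * Gᵀ)).mulVec ε
      + T⁻¹ • (G * Gᵀ - Gh * Ghᵀ).mulVec y := by
    have hproj : T⁻¹ • (G * Gᵀ).mulVec (G.mulVec β) = G.mulVec β := by
      rw [Matrix.mulVec_mulVec, Matrix.mul_assoc, hG, Matrix.mul_smul, Matrix.mul_one,
        Matrix.smul_mulVec, smul_smul, inv_mul_cancel₀ hT.ne', one_smul]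
    have hGy : T⁻¹ • (G * Gᵀ).mulVec y = G.mulVec β + T⁻¹ • (G * Gᵀ).mulVec ε := by
      rw [hy, Matrix.mulVec_add, smul_add, hproj]
    rw [Matrix.sub_mulVec, Matrix.sub_mulVec, Matrix.one_mulVec, Matrix.smul_mulVec, smul_sub,
      hGy, ← hyh]
    nth_rewrite 1 [hy]
    abel
  have h₂ : G * Gᵀ - Gh * Ghᵀ
      = G * ((1 : Matrix (Fin k) (Fin k) ℝ) - Hᵀ * H) * Gᵀ
        - G * Hᵀ * Eᵀ - E * H * Gᵀ - E * Eᵀ := by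
    obtain rfl : Gh = E + G * Hᵀ := by rw [hE, sub_add_cancel]
    simp only [Matrix.transpose_add, Matrix.transpose_mul, Matrix.transpose_transpose,
      Matrix.mul_add, Matrix.add_mul, Matrix.mul_sub, Matrix.sub_mul, Matrix.mul_one,
      Matrix.mul_assoc]
    abel
  refine ⟨h₁, h₂, ?_⟩
  rw [h₁, add_sub_cancel_left, vnorm_smul, abs_of_pos (inv_pos.mpr hT), h₂]
  have hop := opNorm_factor_expansion_le (opNorm_le_sqrt_of_transpose_mul_self hT.le hG) E
    (1 - Hᵀ * H) H
  have hscale : T⁻¹ * (√T ^ 2 * opNorm (1 - Hᵀ * H) + 2 * √T * opNorm H * opNorm E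
        + opNorm E ^ 2)
      = opNorm (1 - Hᵀ * H) + (2 / √T) * opNorm H * opNorm E + T⁻¹ * opNorm E ^ 2 := by
    have hs : √T ≠ 0 := (Real.sqrt_pos.mpr hT).ne'
    have hinv : T⁻¹ = (√T ^ 2)⁻¹ := by rw [Real.sq_sqrt hT.le]
    rw [hinv]
    field_simp
  rw [← hscale, mul_assoc]
  refine mul_le_mul_of_nonneg_left ?_ (inv_pos.mpr hT).le
  exact (vnorm_mulVec_le _ _).trans (mul_le_mul_of_nonneg_right hop (Real.sqrt_nonneg _))
end

section
/- Let β̂ be a Lasso estimator with penalty λ > 0 and suppose: (a) λ ≥ (4/T)·‖Xᵀe‖_∞; and (b) the restricted eigenvalue condition holds with constant κ > 0, i.e., for every δ ∈ ℝ^p with ‖δ_{S^c}‖₁ ≤ 3·‖δ_S‖₁ one has (1/T)·‖Xδ‖² ≥ κ·‖δ‖². If s ≥ 1, then ‖β̂ − β*‖ ≤ 16√s·λ/κ. -/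
open Matrix

/-- The ℓ₁-norm of a vector in `ℝ^n`. -/
def l1norm {n : ℕ} (v : Fin n → ℝ) : ℝ := ∑ i, |v i|

lemma vnorm_sq {n : ℕ} (v : Fin n → ℝ) : vnorm v ^ 2 = ∑ i, (v i) ^ 2 :=
  Real.sq_sqrt (Finset.sum_nonneg fun i _ => sq_nonneg (v i))

lemma vnorm_sub_sq {n : ℕ} (u v : Fin n → ℝ) :
    vnorm (u - v) ^ 2 = vnorm u ^ 2 - 2 * (u ⬝ᵥ v) + vnorm v ^ 2 := by
  simp only [vnorm_sq, dotProduct, Finset.mul_sum, ← Finset.sum_sub_distrib,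
    ← Finset.sum_add_distrib, Pi.sub_apply]
  exact Finset.sum_congr rfl fun i _ => by ring

/-- Hölder's inequality for the pairing of the sup norm with the ℓ₁-norm. -/
lemma dotProduct_le_iSup_abs_mul_l1norm {n : ℕ} (u v : Fin n → ℝ) :
    u ⬝ᵥ v ≤ (⨆ j, |u j|) * l1norm v := by
  rw [dotProduct, l1norm, Finset.mul_sum]
  refine Finset.sum_le_sum fun j _ => (le_abs_self _).trans ?_
  rw [abs_mul]
  exact mul_le_mul_of_nonneg_right
    (le_ciSup (f := fun j => |u j|) (Set.finite_range _).bddAbove j) (abs_nonneg _)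

lemma sum_abs_le_sqrt_card_mul_vnorm {n : ℕ} (S : Finset (Fin n)) (v : Fin n → ℝ) :
    ∑ j ∈ S, |v j| ≤ Real.sqrt S.card * vnorm v := by
  rw [vnorm, ← Real.sqrt_mul (Nat.cast_nonneg _)]
  refine Real.le_sqrt_of_sq_le (sq_sum_le_card_mul_sum_sq.trans ?_)
  simp only [sq_abs]
  exact mul_le_mul_of_nonneg_left
    (Finset.sum_le_univ_sum_of_nonneg fun i => sq_nonneg (v i)) (Nat.cast_nonneg _)

/-- For `b` vanishing off `S`, the ℓ₁-norm drops from `b` to `c` by at most the part of `c - b`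
on `S` minus the part off `S`. -/
lemma l1norm_sub_le_of_support {n : ℕ} (S : Finset (Fin n)) (b c : Fin n → ℝ)
    (hb : ∀ j ∉ S, b j = 0) :
    l1norm b - l1norm c ≤ ∑ j ∈ S, |(c - b) j| - ∑ j ∈ Sᶜ, |(c - b) j| := by
  have hS : ∑ j ∈ S, |b j| ≤ ∑ j ∈ S, |c j| + ∑ j ∈ S, |(c - b) j| := by
    rw [← Finset.sum_add_distrib]
    refine Finset.sum_le_sum fun j _ => ?_
    have := abs_sub_abs_le_abs_sub (b j) (c j)
    rw [abs_sub_comm] at this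
    simp only [Pi.sub_apply]
    linarith
  have hb0 : ∑ j ∈ Sᶜ, |b j| = 0 :=
    Finset.sum_eq_zero fun j hj => by simp [hb j (Finset.mem_compl.1 hj)]
  have hc : ∑ j ∈ Sᶜ, |(c - b) j| = ∑ j ∈ Sᶜ, |c j| :=
    Finset.sum_congr rfl fun j hj => by simp [hb j (Finset.mem_compl.1 hj)]
  rw [l1norm, l1norm, ← Finset.sum_add_sum_compl S, ← Finset.sum_add_sum_compl S]
  linarith

/-- **deterministic Lasso consistency.** If `β̂` minimizes
`b ↦ (1/T)‖y − Xb‖² + λ‖b‖₁` where `y = Xβ* + e`, with (a) `λ ≥ (4/T)‖Xᵀe‖_∞`, and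
(b) the restricted eigenvalue condition `(1/T)‖Xδ‖² ≥ κ‖δ‖²` for all `δ` in the cone
`‖δ_{Sᶜ}‖₁ ≤ 3‖δ_S‖₁`, where `S = {j : β*_j ≠ 0}` has cardinality `s ≥ 1`, then
`‖β̂ − β*‖ ≤ 16√s·λ/κ`. -/
theorem lasso_consistency
    (T p : ℕ) (hT : 0 < T) (hp : 0 < p)
    (X : Matrix (Fin T) (Fin p) ℝ) (βs : Fin p → ℝ) (e : Fin T → ℝ)
    (y : Fin T → ℝ) (hy : y = X.mulVec βs + e)
    (lam : ℝ) (hlam : 0 < lam)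
    (βh : Fin p → ℝ)
    (hmin : ∀ b : Fin p → ℝ,
      (T : ℝ)⁻¹ * vnorm (y - X.mulVec βh) ^ 2 + lam * l1norm βh
        ≤ (T : ℝ)⁻¹ * vnorm (y - X.mulVec b) ^ 2 + lam * l1norm b)
    (S : Finset (Fin p)) (hS : ∀ j, j ∈ S ↔ βs j ≠ 0)
    (hcard : 1 ≤ S.card)
    -- (a) λ ≥ (4/T)·‖Xᵀe‖_∞
    (hnoise : (4 / (T : ℝ)) * (⨆ j, |(Xᵀ.mulVec e) j|) ≤ lam)
    (κ : ℝ) (hκ : 0 < κ)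
    -- (b) restricted eigenvalue condition on the cone C₃(S)
    (hRE : ∀ δ : Fin p → ℝ,
      (∑ j ∈ Sᶜ, |δ j| ≤ 3 * ∑ j ∈ S, |δ j|) →
        κ * vnorm δ ^ 2 ≤ (T : ℝ)⁻¹ * vnorm (X.mulVec δ) ^ 2) :
    vnorm (βh - βs) ≤ 16 * Real.sqrt S.card * lam / κ := by
  set D := βh - βs with hD
  have hT' : (0 : ℝ) < T := Nat.cast_pos.2 hT
  have h_basic := hmin βs
  have h_res : y - X.mulVec βh = e - X.mulVec D := by
    rw [hy, hD, Matrix.mulVec_sub]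
    abel
  have h_res' : y - X.mulVec βs = e := by rw [hy, add_sub_cancel_left]
  rw [h_res, h_res', vnorm_sub_sq] at h_basic
  have h_dot : e ⬝ᵥ X.mulVec D ≤ (⨆ j, |(Xᵀ.mulVec e) j|) * l1norm D := by
    rw [Matrix.dotProduct_mulVec, ← Matrix.mulVec_transpose]
    exact dotProduct_le_iSup_abs_mul_l1norm _ _
  have h_split : l1norm D = ∑ j ∈ S, |D j| + ∑ j ∈ Sᶜ, |D j| :=
    (Finset.sum_add_sum_compl S _).symm
  have h_l1 : 0 ≤ l1norm D := Finset.sum_nonneg fun j _ => abs_nonneg _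
  have h_noise : 4 * ((T : ℝ)⁻¹ * (e ⬝ᵥ X.mulVec D)) ≤ lam * l1norm D :=
    calc 4 * ((T : ℝ)⁻¹ * (e ⬝ᵥ X.mulVec D))
        ≤ 4 * ((T : ℝ)⁻¹ * ((⨆ j, |(Xᵀ.mulVec e) j|) * l1norm D)) := by gcongr
      _ = (4 / (T : ℝ)) * (⨆ j, |(Xᵀ.mulVec e) j|) * l1norm D := by ring
      _ ≤ lam * l1norm D := mul_le_mul_of_nonneg_right hnoise h_l1
  have h_drop := mul_le_mul_of_nonneg_left
    (l1norm_sub_le_of_support S βs βh fun j hj => not_not.1 (mt (hS j).2 hj)) hlam.le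
  rw [← hD] at h_drop
  rw [h_split] at h_noise
  have h_sqrt := sum_abs_le_sqrt_card_mul_vnorm S D
  have h_off : 0 ≤ ∑ j ∈ Sᶜ, |D j| := Finset.sum_nonneg fun j _ => abs_nonneg _
  have h_pred : 0 ≤ (T : ℝ)⁻¹ * vnorm (X.mulVec D) ^ 2 := by positivity
  have h_oracle : (T : ℝ)⁻¹ * vnorm (X.mulVec D) ^ 2
      ≤ lam / 2 * (3 * ∑ j ∈ S, |D j| - ∑ j ∈ Sᶜ, |D j|) := by
    linarith
  have h_cone : ∑ j ∈ Sᶜ, |D j| ≤ 3 * ∑ j ∈ S, |D j| :=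
    sub_nonneg.1 (nonneg_of_mul_nonneg_right (h_pred.trans h_oracle) (half_pos hlam))
  have h_re := hRE D h_cone
  have h_upper : κ * vnorm D ^ 2 ≤ 16 * Real.sqrt S.card * lam * vnorm D :=
    calc κ * vnorm D ^ 2
        ≤ lam / 2 * (3 * ∑ j ∈ S, |D j| - ∑ j ∈ Sᶜ, |D j|) := h_re.trans h_oracle
      _ ≤ lam / 2 * (32 * (Real.sqrt S.card * vnorm D)) := by
        have h_on : 0 ≤ ∑ j ∈ S, |D j| := Finset.sum_nonneg fun j _ => abs_nonneg _
        gcongr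
        linarith
      _ = 16 * Real.sqrt S.card * lam * vnorm D := by ring
  have h_nonneg : 0 ≤ vnorm D := Real.sqrt_nonneg _
  rw [le_div_iff₀ hκ]
  rcases h_nonneg.eq_or_lt with h | h
  · rw [← h, zero_mul]
    positivity
  · refine le_of_mul_le_mul_right ?_ h
    linarith
end
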